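/- Let X, Y : [0,1] → ℝ^d be curves and let p = (x_p, y_p), q = (x_q, y_q), r = (x_r, y_r) be points in [0,1]² with x_p ≤ x_q ≤ x_r. Let δ' = max(‖X(x_p) − Y(y_p)‖, ‖X(x_q) − Y(y_q)‖, ‖X(x_r) − Y(y_r)‖) be the maximum elevation of the three points. Then the price of the tunnel from q to r is at most 3·max(δ', price of the tunnel from p to r). -/

import Mathlib

open Set

noncomputable section

namespace Jaywalk

variable {d : ℕ}

/-- An orientation-preserving reparameterization of `[0,1]`: a continuous, strictly
increasing bijection of `[0,1]` onto itself with `f 0 = 0` and `f 1 = 1`. -/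
structure IsReparam (f : ℝ → ℝ) : Prop where
  contOn : ContinuousOn f (Icc 0 1)
  strictMonoOn : StrictMonoOn f (Icc 0 1)
  mapsTo : MapsTo f (Icc 0 1) (Icc 0 1)
  surjOn : SurjOn f (Icc 0 1) (Icc 0 1)
  map_zero : f 0 = 0
  map_one : f 1 = 1

/-- The width of a reparameterization `f` with respect to curves `X Y : [0,1] → ℝ^d`. -/
def frechetWidth (X Y : ℝ → EuclideanSpace ℝ (Fin d)) (f : ℝ → ℝ) : ℝ :=
  ⨆ t : Icc (0:ℝ) 1, ‖X (f ↑t) - Y ↑t‖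

/-- The Fréchet distance between two curves `X Y : [0,1] → ℝ^d`. -/
def frechetDist (X Y : ℝ → EuclideanSpace ℝ (Fin d)) : ℝ :=
  sInf {w | ∃ f, IsReparam f ∧ w = frechetWidth X Y f}

/-- The segment from `p` to `q`, as a curve `t ↦ (1-t)·p + t·q`. -/
def seg (p q : EuclideanSpace ℝ (Fin d)) : ℝ → EuclideanSpace ℝ (Fin d) :=
  fun t => (1 - t) • p + t • q

/-- The subcurve `Z[s,t]`, affinely reparameterized over `[0,1]`. -/
def subcurve (Z : ℝ → EuclideanSpace ℝ (Fin d)) (s t : ℝ) : ℝ → EuclideanSpace ℝ (Fin d) :=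
  fun τ => Z (s + τ * (t - s))

/-- Vertices extended to all of `ℕ` (clamped at `n`). -/
def vtx {n : ℕ} (v : Fin (n+1) → EuclideanSpace ℝ (Fin d)) (i : ℕ) :
    EuclideanSpace ℝ (Fin d) :=
  v ⟨min i n, Nat.lt_succ_of_le (min_le_right i n)⟩

/-- The uniformly parameterized polygonal curve through the vertices `v 0, …, v n`. -/
def polyCurve {n : ℕ} (v : Fin (n+1) → EuclideanSpace ℝ (Fin d)) :
    ℝ → EuclideanSpace ℝ (Fin d) :=
  fun t =>
    (1 - (t * n - ⌊t * n⌋₊)) • vtx v ⌊t * n⌋₊ + (t * n - ⌊t * n⌋₊) • vtx v (⌊t * n⌋₊ + 1)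

/-- Concatenation of two curves (sharing an endpoint). -/
def concat (A B : ℝ → EuclideanSpace ℝ (Fin d)) : ℝ → EuclideanSpace ℝ (Fin d) :=
  fun t => if t ≤ 1/2 then A (2 * t) else B (2 * t - 1)

/-- Concatenation of a finite list of curves. -/
def concatList : List (ℝ → EuclideanSpace ℝ (Fin d)) → ℝ → EuclideanSpace ℝ (Fin d)
  | [] => fun _ => 0
  | [A] => A
  | A :: B :: rest => concat A (concatList (B :: rest))

/-- Given curves `X Y`, the price of the tunnel from `a` to `b` (points of `[0,1]²`):
the Fréchet distance between the subcurve `X[a.1, b.1]` and the segment from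
`Y a.2` to `Y b.2`. -/
def tunnelPrice (X Y : ℝ → EuclideanSpace ℝ (Fin d)) (a b : ℝ × ℝ) : ℝ :=
  frechetDist (subcurve X a.1 b.1) (seg (Y a.2) (Y b.2))

open Classical in
/-- Indices of marked vertices in the greedy `μ`-simplification of the polygonal curve with
vertices `v 0, …, v n`:  start at vertex `0`; repeatedly jump to the first later vertex at
distance at least `μ` from the current one; finally also mark the last vertex `n`
(the sequence stabilizes at `n`). -/
def simplIdx (v : ℕ → EuclideanSpace ℝ (Fin d)) (μ : ℝ) (n : ℕ) : ℕ → ℕ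
  | 0 => 0
  | k+1 =>
    if h : ∃ j, simplIdx v μ n k < j ∧ j ≤ n ∧ μ ≤ ‖v j - v (simplIdx v μ n k)‖
    then Nat.find h
    else n

/-- The vertices of the `μ`-simplification (with the final vertex repeated). -/
def simplVerts {n : ℕ} (v : Fin (n+1) → EuclideanSpace ℝ (Fin d)) (μ : ℝ) :
    Fin (n+1) → EuclideanSpace ℝ (Fin d) :=
  fun k => vtx v (simplIdx (vtx v) μ n k.val)

/-- The `μ`-simplification `simpl(X, μ)` of the polygonal curve with vertices
`v 0, …, v n`: the polygonal curve through the marked vertices, in order. -/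
def simpl {n : ℕ} (v : Fin (n+1) → EuclideanSpace ℝ (Fin d)) (μ : ℝ) :
    ℝ → EuclideanSpace ℝ (Fin d) :=
  polyCurve (simplVerts v μ)

/-- `y` is the parameter of a vertex of a (uniformly parameterized) polygonal curve
with `n` edges. -/
def vertexParam (n : ℕ) (y : ℝ) : Prop := ∃ i : Fin (n+1), y = ((i : ℕ) : ℝ) / n

/-- The shortcut curve of `Y` determined by the list of shortcut parameter pairs,
starting from parameter `a`. -/
def shortcutFrom (Y : ℝ → EuclideanSpace ℝ (Fin d)) :
    List (ℝ × ℝ) → ℝ → ℝ → EuclideanSpace ℝ (Fin d)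
  | [], a => subcurve Y a 1
  | (y₁, y₂) :: rest, a =>
      concat (subcurve Y a y₁) (concat (seg (Y y₁) (Y y₂)) (shortcutFrom Y rest y₂))

/-- The shortcut parameter pairs form a nondecreasing sequence inside `[0,1]` and all
parameters are vertices of the polygonal curve with `n` edges. -/
def ValidShortcuts (n : ℕ) (L : List (ℝ × ℝ)) : Prop :=
  List.Chain' (· ≤ ·) ((0:ℝ) :: (L.flatMap fun p => [p.1, p.2]) ++ [1]) ∧
  ∀ p ∈ L, vertexParam n p.1 ∧ vertexParam n p.2

/-- The directed vertex-restricted `k`-shortcut Fréchet distance between a curve `X` and the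
polygonal curve with vertices `w 0, …, w n`: the infimum of the Fréchet distance between `X`
and any vertex-restricted shortcut curve of `polyCurve w` with at most `k` shortcuts. -/
def shortcutFrechetDist {n : ℕ} (X : ℝ → EuclideanSpace ℝ (Fin d))
    (w : Fin (n+1) → EuclideanSpace ℝ (Fin d)) (k : ℕ) : ℝ :=
  sInf {r | ∃ L : List (ℝ × ℝ), L.length ≤ k ∧ ValidShortcuts n L ∧
    r = frechetDist X (shortcutFrom (polyCurve w) L 0)}

/-- The directed vertex-restricted shortcut Fréchet distance (unbounded number of
shortcuts). -/
def shortcutFrechetDistUnbounded {n : ℕ} (X : ℝ → EuclideanSpace ℝ (Fin d))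
    (w : Fin (n+1) → EuclideanSpace ℝ (Fin d)) : ℝ :=
  sInf {r | ∃ L : List (ℝ × ℝ), ValidShortcuts n L ∧
    r = frechetDist X (shortcutFrom (polyCurve w) L 0)}

theorem isReparam_id : IsReparam id where
  contOn := continuousOn_id
  strictMonoOn := strictMono_id.strictMonoOn _
  mapsTo := mapsTo_id _
  surjOn := surjOn_id _
  map_zero := rfl
  map_one := rfl

/-- The restriction of a reparameterization to `[s,1]`, rescaled to `[0,1]`. -/
theorem IsReparam.tail {f : ℝ → ℝ} (hf : IsReparam f) {s : ℝ} (hs : s ∈ Ico (0 : ℝ) 1) :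
    IsReparam fun t => (f (s + t * (1 - s)) - f s) / (1 - f s) := by
  obtain ⟨hs0, hs1⟩ := hs
  have hfs : 0 < 1 - f s := by
    have := hf.strictMonoOn ⟨hs0, hs1.le⟩ (right_mem_Icc.2 zero_le_one) hs1
    rw [hf.map_one] at this
    linarith
  have hmaps : MapsTo (fun t => s + t * (1 - s)) (Icc 0 1) (Icc 0 1) := by
    rintro t ⟨h0, h1⟩
    constructor <;> nlinarith
  have hmono : StrictMonoOn (fun t => (f (s + t * (1 - s)) - f s) / (1 - f s)) (Icc 0 1) := by
    intro a ha b hb hab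
    have := hf.strictMonoOn (hmaps ha) (hmaps hb)
      (by nlinarith : s + a * (1 - s) < s + b * (1 - s))
    exact div_lt_div_of_pos_right (by linarith) hfs
  have hcont : ContinuousOn (fun t => (f (s + t * (1 - s)) - f s) / (1 - f s)) (Icc 0 1) :=
    ((hf.contOn.comp (by fun_prop) hmaps).sub continuousOn_const).div_const _
  have h0 : (f (s + 0 * (1 - s)) - f s) / (1 - f s) = 0 := by simp
  have h1 : (f (s + 1 * (1 - s)) - f s) / (1 - f s) = 1 := by
    rw [show s + 1 * (1 - s) = 1 by ring, hf.map_one, div_self hfs.ne']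
  refine ⟨hcont, hmono, fun t ht => ⟨?_, ?_⟩, ?_, h0, h1⟩
  · exact h0.ge.trans (hmono.monotoneOn (left_mem_Icc.2 zero_le_one) ht ht.1)
  · exact (hmono.monotoneOn ht (right_mem_Icc.2 zero_le_one) ht.2).trans h1.le
  · have := intermediate_value_Icc (zero_le_one (α := ℝ)) hcont
    simp only [h0, h1] at this
    exact this

theorem frechetDist_le {X Y : ℝ → EuclideanSpace ℝ (Fin d)} {f : ℝ → ℝ} {c : ℝ}
    (hf : IsReparam f) (h : ∀ t ∈ Icc (0 : ℝ) 1, ‖X (f t) - Y t‖ ≤ c) :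
    frechetDist X Y ≤ c := by
  have hbdd : BddBelow {w | ∃ f, IsReparam f ∧ w = frechetWidth X Y f} := by
    refine ⟨0, ?_⟩
    rintro w ⟨g, -, rfl⟩
    exact Real.iSup_nonneg fun _ => norm_nonneg _
  exact (csInf_le hbdd ⟨f, hf, rfl⟩).trans (ciSup_le fun t => h t t.2)

theorem exists_isReparam_of_frechetDist_lt {X Y : ℝ → EuclideanSpace ℝ (Fin d)} {c : ℝ}
    (hX : ContinuousOn X (Icc 0 1)) (hY : ContinuousOn Y (Icc 0 1))
    (h : frechetDist X Y < c) :
    ∃ f, IsReparam f ∧ ∀ t ∈ Icc (0 : ℝ) 1, ‖X (f t) - Y t‖ ≤ c := by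
  obtain ⟨_, ⟨f, hf, rfl⟩, hlt⟩ := exists_lt_of_csInf_lt
    (s := {w | ∃ f, IsReparam f ∧ w = frechetWidth X Y f}) ⟨_, id, isReparam_id, rfl⟩ h
  refine ⟨f, hf, fun t ht => le_trans ?_ hlt.le⟩
  have hbdd : BddAbove (range fun t : Icc (0 : ℝ) 1 => ‖X (f t) - Y t‖) := by
    have := isCompact_Icc.bddAbove_image ((hX.comp hf.contOn hf.mapsTo).sub hY).norm
    rwa [image_eq_range] at this
  exact le_ciSup hbdd ⟨t, ht⟩

theorem continuous_seg (a b : EuclideanSpace ℝ (Fin d)) : Continuous (seg a b) := by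
  unfold seg
  fun_prop

theorem continuousOn_subcurve {Z : ℝ → EuclideanSpace ℝ (Fin d)} {s t : ℝ}
    (hZ : ContinuousOn Z (Icc 0 1)) (hs : s ∈ Icc (0 : ℝ) 1) (ht : t ∈ Icc (0 : ℝ) 1) :
    ContinuousOn (subcurve Z s t) (Icc 0 1) := by
  refine hZ.comp (f := fun τ => s + τ * (t - s)) (by fun_prop) ?_
  rintro τ ⟨h0, h1⟩
  have h := (convex_Icc (0 : ℝ) 1) hs ht (sub_nonneg.2 h1) h0 (by ring)
  simp only [smul_eq_mul] at h
  convert h using 1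
  ring

theorem norm_sub_seg_le {x a b : EuclideanSpace ℝ (Fin d)} {c t : ℝ}
    (ha : ‖x - a‖ ≤ c) (hb : ‖x - b‖ ≤ c) (ht : t ∈ Icc (0 : ℝ) 1) :
    ‖x - seg a b t‖ ≤ c := by
  rw [← mem_closedBall_iff_norm'] at ha hb ⊢
  exact convex_closedBall x c ha hb (sub_nonneg.2 ht.2) ht.1 (by ring)

theorem norm_seg_sub_seg_left_le (a b e : EuclideanSpace ℝ (Fin d)) {t : ℝ}
    (ht : t ∈ Icc (0 : ℝ) 1) : ‖seg a e t - seg b e t‖ ≤ ‖a - b‖ := by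
  have : seg a e t - seg b e t = (1 - t) • (a - b) := by
    simp only [seg]
    module
  rw [this, norm_smul, Real.norm_of_nonneg (sub_nonneg.2 ht.2)]
  exact mul_le_of_le_one_left (norm_nonneg _) (by linarith [ht.1])

theorem seg_seg_left (a b : EuclideanSpace ℝ (Fin d)) (s t : ℝ) :
    seg (seg a b s) b t = seg a b (s + t * (1 - s)) := by
  simp only [seg]
  module

/-- Monotonicity of tunnel prices: for points `p, q, r ∈ [0,1]²` with
`x_p ≤ x_q ≤ x_r` and maximum elevation `δ'`, the price of the tunnel from `q` to `r` is at
most `3·max(δ', price of the tunnel from p to r)`. -/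
theorem tunnelPrice_mono {d : ℕ} (X Y : ℝ → EuclideanSpace ℝ (Fin d))
    (hX : ContinuousOn X (Icc 0 1)) (hY : ContinuousOn Y (Icc 0 1))
    (p q r : ℝ × ℝ)
    (hp : p ∈ (Icc (0:ℝ) 1) ×ˢ (Icc (0:ℝ) 1))
    (hq : q ∈ (Icc (0:ℝ) 1) ×ˢ (Icc (0:ℝ) 1))
    (hr : r ∈ (Icc (0:ℝ) 1) ×ˢ (Icc (0:ℝ) 1))
    (hpq : p.1 ≤ q.1) (hqr : q.1 ≤ r.1) :
    tunnelPrice X Y q r ≤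
      3 * max (max ‖X p.1 - Y p.2‖ (max ‖X q.1 - Y q.2‖ ‖X r.1 - Y r.2‖))
        (tunnelPrice X Y p r) := by
  obtain ⟨xp, yp⟩ := p
  obtain ⟨xq, yq⟩ := q
  obtain ⟨xr, yr⟩ := r
  simp only [tunnelPrice, mem_prod] at *
  set δ := max ‖X xp - Y yp‖ (max ‖X xq - Y yq‖ ‖X xr - Y yr‖)
  set M := max δ (frechetDist (subcurve X xp xr) (seg (Y yp) (Y yr)))
  have hqM : ‖X xq - Y yq‖ ≤ M :=
    (le_max_left _ _).trans ((le_max_right _ _).trans (le_max_left _ _))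
  have hrM : ‖X xr - Y yr‖ ≤ M :=
    (le_max_right _ _).trans ((le_max_right _ _).trans (le_max_left _ _))
  have hM : 0 ≤ M := (norm_nonneg _).trans hqM
  obtain rfl | hlt := hqr.eq_or_lt
  · refine frechetDist_le isReparam_id fun t ht => ?_
    have : subcurve X xq xq (id t) = X xq := by simp [subcurve]
    rw [this]
    exact (norm_sub_seg_le hqM hrM ht).trans (by linarith)
  refine le_of_forall_pos_le_add fun ε hε => ?_
  obtain ⟨f, hf, hfw⟩ := exists_isReparam_of_frechetDist_lt (c := M + ε / 2)
    (continuousOn_subcurve hX hp.1 hr.1) (continuous_seg (Y yp) (Y yr)).continuousOn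
    ((le_max_right δ _).trans_lt (by linarith : M < M + ε / 2))
  have hL : 0 < xr - xp := by linarith
  obtain ⟨s, hs, hfs⟩ := hf.surjOn (a := (xq - xp) / (xr - xp))
    ⟨div_nonneg (by linarith) hL.le, (div_le_one hL).2 (by linarith)⟩
  have hfs1 : f s < 1 := by rw [hfs, div_lt_one hL]; linarith
  have hs1 : s < 1 := lt_of_le_of_ne hs.2 fun h => by
    rw [h, hf.map_one] at hfs1
    exact lt_irrefl _ hfs1
  have hxq : xq = xp + f s * (xr - xp) := by rw [hfs]; field_simp; ring
  refine frechetDist_le (hf.tail ⟨hs.1, hs1⟩) fun t ht => ?_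
  have hX' : subcurve X xq xr ((f (s + t * (1 - s)) - f s) / (1 - f s)) =
      subcurve X xp xr (f (s + t * (1 - s))) := by
    have : 1 - f s ≠ 0 := by linarith
    simp only [subcurve]
    congr 1
    rw [hxq]
    field_simp
    ring
  have hst : s + t * (1 - s) ∈ Icc (0 : ℝ) 1 := by
    constructor <;> nlinarith [hs.1, ht.1, ht.2]
  have hdist := hfw _ hst
  rw [← seg_seg_left] at hdist
  have hZ : ‖seg (Y yp) (Y yr) s - X xq‖ ≤ M + ε / 2 := by
    rw [norm_sub_rev]
    simpa only [subcurve, ← hxq] using hfw s hs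
  have hZq := norm_sub_le_norm_sub_add_norm_sub (seg (Y yp) (Y yr) s) (X xq) (Y yq)
  have hseg := norm_seg_sub_seg_left_le (seg (Y yp) (Y yr) s) (Y yq) (Y yr) ht
  rw [hX']
  refine (norm_sub_le_norm_sub_add_norm_sub _ (seg (seg (Y yp) (Y yr) s) (Y yr) t) _).trans ?_
  linarith

end Jaywalk
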